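/- Let m be a square-free positive integer with m ≡ 2 or 3 (mod 4), let θ = m^(1/4) be the real positive fourth root of m, and let K = ℚ(i, θ). Then 2^16 · m^6 divides the absolute value of the discriminant of the number field K. -/

import Mathlib

open NumberField

/-- The real positive fourth root of `m`, viewed as a complex number. -/
noncomputable def theta (m : ℕ) : ℂ := ((m : ℝ) ^ ((1 : ℝ) / 4) : ℝ)

/-- The octic field `K = ℚ(i, m^(1/4))` as a subfield of `ℂ`. -/
noncomputable def Kfield (m : ℕ) : IntermediateField ℚ ℂ :=
  IntermediateField.adjoin ℚ {Complex.I, theta m}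

open Complex in
/-- The subring `ℚ(i)` of `ℂ`. -/
def gaussianRat : Subalgebra ℚ ℂ where
  carrier := {z | ∃ a b : ℚ, z = a + b * I}
  mul_mem' := by
    rintro _ _ ⟨a, b, rfl⟩ ⟨c, d, rfl⟩
    refine ⟨a * c - b * d, a * d + b * c, ?_⟩
    push_cast
    linear_combination (b * d : ℂ) * I_sq
  add_mem' := by
    rintro _ _ ⟨a, b, rfl⟩ ⟨c, d, rfl⟩
    exact ⟨a + c, b + d, by push_cast; ring⟩
  algebraMap_mem' r := ⟨r, 0, by simp⟩

theorem I_mem_gaussianRat : Complex.I ∈ gaussianRat := ⟨0, 1, by simp⟩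

theorem exists_int_of_isIntegral {q : ℚ} (h : IsIntegral ℤ (q : ℂ)) : ∃ n : ℤ, (n : ℚ) = q := by
  have h' : IsIntegral ℤ (algebraMap ℚ ℂ q) := by simpa using h
  rw [isIntegral_algebraMap_iff (algebraMap ℚ ℂ).injective] at h'
  obtain ⟨n, hn⟩ := IsIntegrallyClosed.isIntegral_iff.mp h'
  exact ⟨n, by simpa using hn⟩

theorem isIntegral_I : IsIntegral ℤ Complex.I :=
  .of_pow (n := 2) two_pos (by rw [Complex.I_sq]; exact isIntegral_one.neg)

open Complex in
theorem exists_gaussianInt_of_isIntegral {z : ℂ} (hz : z ∈ gaussianRat) (h : IsIntegral ℤ z) :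
    ∃ g : GaussianInt, (g : ℂ) = z := by
  obtain ⟨a, b, rfl⟩ := hz
  have hc : IsIntegral ℤ (a - b * I : ℂ) := by
    have := h.map (Complex.conjAe.restrictScalars ℤ)
    simpa [sub_eq_add_neg] using this
  obtain ⟨A, hA⟩ := exists_int_of_isIntegral (q := 2 * a) (by
    have := h.add hc
    rwa [show a + b * I + (a - b * I) = ((2 * a : ℚ) : ℂ) by push_cast; ring] at this)
  obtain ⟨B, hB⟩ := exists_int_of_isIntegral (q := 2 * b) (by
    have := (h.sub hc).mul isIntegral_I.neg
    rwa [show (a + b * I - (a - b * I)) * -I = ((2 * b : ℚ) : ℂ) by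
      push_cast; linear_combination (-2 * b : ℂ) * I_sq] at this)
  obtain ⟨N, hN⟩ := exists_int_of_isIntegral (q := a ^ 2 + b ^ 2) (by
    have := h.mul hc
    rwa [show (a + b * I) * (a - b * I) = ((a ^ 2 + b ^ 2 : ℚ) : ℂ) by
      push_cast; linear_combination (-b ^ 2 : ℂ) * I_sq] at this)
  have key : A ^ 2 + B ^ 2 = 4 * N := by
    have : (A : ℚ) ^ 2 + B ^ 2 = 4 * N := by rw [hA, hB, hN]; ring
    exact_mod_cast this
  have hAB : A % 2 = 0 ∧ B % 2 = 0 := by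
    rcases Int.even_or_odd' A with ⟨a', rfl | rfl⟩ <;>
      rcases Int.even_or_odd' B with ⟨b', rfl | rfl⟩ <;>
    (ring_nf at key; omega)
  obtain ⟨a', rfl⟩ := Int.dvd_of_emod_eq_zero hAB.1
  obtain ⟨b', rfl⟩ := Int.dvd_of_emod_eq_zero hAB.2
  have ha : (a' : ℚ) = a := by push_cast at hA; linarith
  have hb : (b' : ℚ) = b := by push_cast at hB; linarith
  refine ⟨⟨a', b'⟩, ?_⟩
  rw [GaussianInt.toComplex_def', ← ha, ← hb]
  push_cast
  rfl

namespace GaussianInt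

theorem one_add_I_dvd {A : GaussianInt} (h : (2 : ℤ) ∣ A.re - A.im) :
    (⟨1, 1⟩ : GaussianInt) ∣ A := by
  obtain ⟨c, hc⟩ := h
  refine ⟨⟨A.im + c, -c⟩, ?_⟩
  ext
  · simp; linarith
  · simp

/-- The square of a Gaussian integer is real modulo `2`. -/
theorem one_add_I_dvd_of_two_dvd {A B : GaussianInt} {n : ℤ} (hn : Odd n)
    (h : (2 : GaussianInt) ∣ A ^ 2 + ⟨0, 1⟩ * n * B ^ 2) :
    (⟨1, 1⟩ : GaussianInt) ∣ A ∧ (⟨1, 1⟩ : GaussianInt) ∣ B := by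
  have h' : (((2 : ℤ) : GaussianInt)) ∣ A ^ 2 + ⟨0, 1⟩ * n * B ^ 2 := by exact_mod_cast h
  rw [Zsqrtd.intCast_dvd] at h'
  obtain ⟨⟨a, b⟩, ⟨c, d⟩⟩ := A, B
  obtain ⟨h1, h2⟩ := h'
  simp [pow_two] at h1 h2
  constructor <;> apply one_add_I_dvd <;> simp only
  · rw [← even_iff_two_dvd] at h1 ⊢
    simp only [parity_simps] at h1 ⊢
    grind
  · rw [← even_iff_two_dvd] at h2 ⊢
    simp only [parity_simps] at h2 ⊢
    grind

theorem one_add_I_sq : (⟨1, 1⟩ : GaussianInt) ^ 2 = 2 * ⟨0, 1⟩ := by decide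

theorem I_sq : (⟨0, 1⟩ : GaussianInt) ^ 2 = -1 := by decide

theorem two_dvd_of_four_dvd {A B : GaussianInt} {n : ℤ} (hn : Odd n)
    (h : (4 : GaussianInt) ∣ A ^ 2 + ⟨0, 1⟩ * n * B ^ 2) :
    (2 : GaussianInt) ∣ A ∧ (2 : GaussianInt) ∣ B := by
  obtain ⟨⟨A, rfl⟩, ⟨B, rfl⟩⟩ :=
    one_add_I_dvd_of_two_dvd hn (.trans ⟨2, by norm_num⟩ h)
  obtain ⟨g, hg⟩ := h
  obtain ⟨⟨A, rfl⟩, ⟨B, rfl⟩⟩ := one_add_I_dvd_of_two_dvd (A := A) (B := B) hn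
    ⟨-⟨0, 1⟩ * g, mul_left_cancel₀ (two_ne_zero (α := GaussianInt)) (by
      linear_combination (-⟨0, 1⟩) * hg + ⟨0, 1⟩ * (A ^ 2 + ⟨0, 1⟩ * n * B ^ 2) * one_add_I_sq
        + 2 * (A ^ 2 + ⟨0, 1⟩ * n * B ^ 2) * I_sq)⟩
  exact ⟨⟨⟨0, 1⟩ * A, by linear_combination A * one_add_I_sq⟩,
    ⟨⟨0, 1⟩ * B, by linear_combination B * one_add_I_sq⟩⟩

theorem one_add_I_dvd_of_system {k : ℤ} {A B C D : GaussianInt}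
    (h1 : (2 : GaussianInt) ∣
      A ^ 2 - k * B ^ 2 - ⟨0, 1⟩ * (C ^ 2 - k * D ^ 2 + 2 * k * (2 * C * D + D ^ 2)))
    (h2 : (2 : GaussianInt) ∣
      2 * A * B + B ^ 2 + ⟨0, 1⟩ * (2 * C * D + D ^ 2 + 2 * (C ^ 2 - k * D ^ 2))) :
    ((⟨1, 1⟩ : GaussianInt) ∣ A ∧ (⟨1, 1⟩ : GaussianInt) ∣ B) ∧
      (⟨1, 1⟩ : GaussianInt) ∣ C ∧ (⟨1, 1⟩ : GaussianInt) ∣ D := by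
  obtain ⟨g, hg⟩ := h1
  obtain ⟨l, hl⟩ := h2
  obtain ⟨⟨B, rfl⟩, ⟨D, rfl⟩⟩ := one_add_I_dvd_of_two_dvd (A := B) (B := D) (n := 1) odd_one
    ⟨l - A * B - ⟨0, 1⟩ * (C * D + C ^ 2 - k * D ^ 2), by push_cast; linear_combination hl⟩
  obtain ⟨hA, hC⟩ := one_add_I_dvd_of_two_dvd (A := A) (B := C) (n := -1) (by decide)
    ⟨g + k * ⟨0, 1⟩ * B ^ 2 + ⟨0, 1⟩ * (- k * ⟨0, 1⟩ * D ^ 2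
        + k * (2 * C * (⟨1, 1⟩ * D) + (⟨1, 1⟩ * D) ^ 2)), by
      push_cast
      linear_combination hg + (k * B ^ 2 - ⟨0, 1⟩ * k * D ^ 2) * one_add_I_sq⟩
  exact ⟨⟨hA, dvd_mul_right _ _⟩, hC, dvd_mul_right _ _⟩

theorem two_dvd_of_system {k : ℤ} {A B C D : GaussianInt}
    (h1 : (4 : GaussianInt) ∣
      A ^ 2 - k * B ^ 2 - ⟨0, 1⟩ * (C ^ 2 - k * D ^ 2 + 2 * k * (2 * C * D + D ^ 2)))
    (h2 : (4 : GaussianInt) ∣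
      2 * A * B + B ^ 2 + ⟨0, 1⟩ * (2 * C * D + D ^ 2 + 2 * (C ^ 2 - k * D ^ 2))) :
    (2 : GaussianInt) ∣ D := by
  have h24 : (2 : GaussianInt) ∣ 4 := ⟨2, by norm_num⟩
  obtain ⟨⟨⟨A, rfl⟩, ⟨B, rfl⟩⟩, ⟨⟨C, rfl⟩, ⟨D, rfl⟩⟩⟩ :=
    one_add_I_dvd_of_system (h24.trans h1) (h24.trans h2)
  obtain ⟨g, hg⟩ := h1
  obtain ⟨l, hl⟩ := h2
  obtain ⟨-, -, ⟨D, rfl⟩⟩ := one_add_I_dvd_of_system (k := k) (A := A) (B := B) (C := C) (D := D)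
    ⟨-⟨0, 1⟩ * g, mul_left_cancel₀ (two_ne_zero (α := GaussianInt)) (by
      linear_combination (-⟨0, 1⟩) * hg +
        (A ^ 2 - k * B ^ 2 - ⟨0, 1⟩ * (C ^ 2 - k * D ^ 2 + 2 * k * (2 * C * D + D ^ 2))) *
          (⟨0, 1⟩ * one_add_I_sq + 2 * I_sq))⟩
    ⟨-⟨0, 1⟩ * l, mul_left_cancel₀ (two_ne_zero (α := GaussianInt)) (by
      linear_combination (-⟨0, 1⟩) * hl +
        (2 * A * B + B ^ 2 + ⟨0, 1⟩ * (2 * C * D + D ^ 2 + 2 * (C ^ 2 - k * D ^ 2))) *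
          (⟨0, 1⟩ * one_add_I_sq + 2 * I_sq))⟩
  exact ⟨⟨0, 1⟩ * D, by linear_combination D * one_add_I_sq⟩

theorem two_dvd_of_ramified_system {n : ℤ} (hn : Odd n) {A B C D E F : GaussianInt}
    (h1 : ⟨1, 1⟩ * (A ^ 2 - ⟨0, 1⟩ * n * B ^ 2) + 2 * ⟨0, 1⟩ * n * C * D = 4 * ⟨1, 1⟩ * E)
    (h2 : 2 * ⟨1, 1⟩ * A * B - (C ^ 2 - ⟨0, 1⟩ * n * D ^ 2) = 4 * ⟨1, 1⟩ * F) :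
    (2 : GaussianInt) ∣ D := by
  have hπ : (⟨1, 1⟩ : GaussianInt) ≠ 0 := by decide
  obtain ⟨⟨C, rfl⟩, ⟨D, rfl⟩⟩ := one_add_I_dvd_of_two_dvd (A := C) (B := D) hn.neg
    ⟨⟨1, 1⟩ * A * B - 2 * ⟨1, 1⟩ * F, by push_cast; linear_combination -h2⟩
  obtain ⟨⟨A, rfl⟩, ⟨B, rfl⟩⟩ := one_add_I_dvd_of_two_dvd (A := A) (B := B) hn.neg
    ⟨2 * E - ⟨0, 1⟩ * ⟨1, 1⟩ * n * C * D,
      mul_left_cancel₀ hπ (by push_cast; linear_combination h1)⟩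
  obtain ⟨-, ⟨D, rfl⟩⟩ := one_add_I_dvd_of_two_dvd (A := C) (B := D) hn.neg
    ⟨⟨1, 1⟩ * A * B + ⟨0, 1⟩ * ⟨1, 1⟩ * F,
      mul_left_cancel₀ (pow_ne_zero 2 hπ) (by
        push_cast
        linear_combination -h2 - 4 * ⟨1, 1⟩ * F * I_sq -
          2 * ⟨0, 1⟩ * ⟨1, 1⟩ * F * one_add_I_sq)⟩
  exact ⟨⟨0, 1⟩ * D, by linear_combination D * one_add_I_sq⟩

end GaussianInt

section Coordinates

open Complex

theorem isIntegral_of_eq {x y : ℂ} (h : IsIntegral ℤ x) (e : y = x) : IsIntegral ℤ y := e ▸ h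

theorem Complex.isIntegral_intCast (n : ℤ) : IsIntegral ℤ (n : ℂ) :=
  isIntegral_algebraMap (R := ℤ) (A := ℂ) (x := n)

theorem isIntegral_gaussianInt (g : GaussianInt) : IsIntegral ℤ (g : ℂ) := by
  rw [GaussianInt.toComplex_def]
  exact (isIntegral_intCast _).add ((isIntegral_intCast _).mul isIntegral_I)

theorem GaussianInt.toComplex_two : GaussianInt.toComplex 2 = 2 := map_ofNat _ 2

theorem GaussianInt.toComplex_four : GaussianInt.toComplex 4 = 4 := map_ofNat _ 4

variable {θ m c₀ c₁ c₂ c₃ : ℂ}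

/-- An element and its conjugates over `ℚ(i)` are integral. -/
theorem isIntegral_conjugates (hθm : θ ^ 4 = m)
    (h : ∀ t : ℂ, t ^ 4 = m → IsIntegral ℤ (c₀ + c₁ * t + c₂ * t ^ 2 + c₃ * t ^ 3)) :
    IsIntegral ℤ (c₀ + c₁ * θ + c₂ * θ ^ 2 + c₃ * θ ^ 3) ∧
    IsIntegral ℤ (c₀ - c₁ * θ + c₂ * θ ^ 2 - c₃ * θ ^ 3) ∧
    IsIntegral ℤ (c₀ + I * c₁ * θ - c₂ * θ ^ 2 - I * c₃ * θ ^ 3) ∧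
    IsIntegral ℤ (c₀ - I * c₁ * θ - c₂ * θ ^ 2 + I * c₃ * θ ^ 3) := by
  refine ⟨h θ hθm, ?_, ?_, ?_⟩
  · exact isIntegral_of_eq (h (-θ) (by rw [← hθm]; ring)) (by ring)
  · exact isIntegral_of_eq (h (I * θ) (by rw [← hθm, mul_pow, I_pow_four, one_mul]))
      (by linear_combination (-c₂ * θ ^ 2 - I * c₃ * θ ^ 3) * I_sq)
  · exact isIntegral_of_eq (h (-(I * θ)) (by rw [← hθm, neg_pow, mul_pow, I_pow_four]; ring))
      (by linear_combination (-c₂ * θ ^ 2 + I * c₃ * θ ^ 3) * I_sq)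

theorem exists_gaussianInt_of_odd {m k : ℤ} (hmk : m = 4 * k - 1) (hθm : θ ^ 4 = m)
    (hc₀ : c₀ ∈ gaussianRat) (hc₁ : c₁ ∈ gaussianRat) (hc₂ : c₂ ∈ gaussianRat)
    (hc₃ : c₃ ∈ gaussianRat)
    (h : ∀ t : ℂ, t ^ 4 = m → IsIntegral ℤ (c₀ + c₁ * t + c₂ * t ^ 2 + c₃ * t ^ 3)) :
    ∃ g : GaussianInt, (g : ℂ) = 2 * m ^ 2 * c₃ := by
  obtain ⟨h₁, h₂, h₃, h₄⟩ := isIntegral_conjugates hθm h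
  have hI := isIntegral_I
  have hIm := I_mem_gaussianRat
  have hm := Complex.isIntegral_intCast m
  have hmm : (m : ℂ) ∈ gaussianRat := intCast_mem _ _
  have hkm : (k : ℂ) ∈ gaussianRat := intCast_mem _ _
  have h2m : (2 : ℂ) ∈ gaussianRat := ofNat_mem _ 2
  have hmk' : (m : ℂ) = 4 * k - 1 := by rw [hmk]; push_cast; ring
  have hθ : IsIntegral ℤ θ := .of_pow (n := 4) (by norm_num) (hθm ▸ hm)
  obtain ⟨ω, hω⟩ : ∃ ω : ℂ, ω = (1 + I * θ ^ 2) / 2 := ⟨_, rfl⟩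
  have hω2 : ω ^ 2 = ω - k := by
    rw [hω]; linear_combination (θ ^ 4 / 4) * I_sq - hθm / 4 - hmk' / 4
  have hθω : θ ^ 2 = I - 2 * I * ω := by rw [hω]; linear_combination (θ ^ 2) * I_sq
  have hωi : IsIntegral ℤ ω := by
    refine ⟨Polynomial.X ^ 2 - Polynomial.X + Polynomial.C k, by monicity!, ?_⟩
    rw [Polynomial.eval₂_add, Polynomial.eval₂_sub, Polynomial.eval₂_X_pow, Polynomial.eval₂_X,
      Polynomial.eval₂_C, hω2, eq_intCast]
    ring
  obtain ⟨B, hB⟩ := exists_gaussianInt_of_isIntegral (z := 2 * m ^ 2 * (-(2 * I) * c₂))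
    (by
      repeat with_reducible first
        | assumption | apply mul_mem | apply pow_mem | apply add_mem | apply sub_mem | apply neg_mem)
    (isIntegral_of_eq (((hI.mul hm).neg.mul (hθ.pow 2)).mul ((h₁.add h₂).sub (h₃.add h₄)))
      (by linear_combination 4 * I * m * c₂ * hθm))
  obtain ⟨D, hD⟩ := exists_gaussianInt_of_isIntegral (z := 2 * m ^ 2 * (-(2 * I) * c₃))
    (by
      repeat with_reducible first
        | assumption | apply mul_mem | apply pow_mem | apply add_mem | apply sub_mem | apply neg_mem)
    (isIntegral_of_eq (((hI.mul hm).neg.mul hθ).mul ((h₁.sub h₂).add (hI.mul (h₃.sub h₄))))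
      (by linear_combination 4 * I * m * c₃ * hθm - I * m * (- 2 * c₁ * θ ^ 2
            + 2 * c₃ * θ ^ 4) * I_sq))
  obtain ⟨A, hA⟩ := exists_gaussianInt_of_isIntegral (z := 2 * m ^ 2 * (c₀ + I * c₂))
    (by
      repeat with_reducible first
        | assumption | apply mul_mem | apply pow_mem | apply add_mem | apply sub_mem | apply neg_mem)
    (isIntegral_of_eq (((hm.pow 2).mul (h₁.add h₂)).sub ((isIntegral_gaussianInt B).mul hωi))
      (by rw [hB]; linear_combination (-2 * m ^ 2 * c₂) * hθω))
  obtain ⟨C, hC⟩ := exists_gaussianInt_of_isIntegral (z := 2 * m ^ 2 * (c₁ + I * c₃))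
    (by
      repeat with_reducible first
        | assumption | apply mul_mem | apply pow_mem | apply add_mem | apply sub_mem | apply neg_mem)
    (isIntegral_of_eq ((hm.mul ((h₁.sub h₂).mul (hθ.pow 3))).sub ((isIntegral_gaussianInt D).mul hωi))
      (by rw [hD]; linear_combination (-2 * m ^ 2 * c₃) * hθω - 2 * m * (c₁ + c₃ * θ ^ 2) * hθm))
  obtain ⟨F, hF⟩ := exists_gaussianInt_of_isIntegral
    (z := m * (-(2 * I) * (2 * c₀ * c₂ - c₁ ^ 2 - m * c₃ ^ 2)))
    (by
      repeat with_reducible first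
        | assumption | apply mul_mem | apply pow_mem | apply add_mem | apply sub_mem | apply neg_mem)
    (isIntegral_of_eq (hI.neg.mul (((h₁.mul h₂).sub (h₃.mul h₄)).mul (hθ.pow 2))) (by
      grind))
  obtain ⟨E, hE⟩ := exists_gaussianInt_of_isIntegral
    (z := m * (c₀ ^ 2 + m * c₂ ^ 2 - 2 * m * c₁ * c₃ + I * (2 * c₀ * c₂ - c₁ ^ 2 - m * c₃ ^ 2)))
    (by
      repeat with_reducible first
        | assumption | apply mul_mem | apply pow_mem | apply add_mem | apply sub_mem | apply neg_mem)
    (isIntegral_of_eq ((hm.mul (h₁.mul h₂)).sub ((isIntegral_gaussianInt F).mul hωi)) (by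
      grind))
  have of_mul {x y : GaussianInt} (hxy : m * x = 4 * y) : (4 : GaussianInt) ∣ x :=
    ⟨k * x - y, by rw [hmk] at hxy; push_cast at hxy; linear_combination -hxy⟩
  obtain ⟨D, rfl⟩ := GaussianInt.two_dvd_of_system (k := k) (A := A) (B := B) (C := C) (D := D)
    (of_mul (y := m ^ 4 * E) (GaussianInt.toComplex_injective (by
      simp only [map_add, map_sub, map_mul, map_pow, map_intCast, GaussianInt.toComplex_def',
        GaussianInt.toComplex_two, GaussianInt.toComplex_four, hA, hB, hC, hD, hE,
        Int.cast_one, Int.cast_zero]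
      have hI2 := I_sq
      clear * - hI2 hmk'
      grind)))
    (of_mul (y := m ^ 4 * F) (GaussianInt.toComplex_injective (by
      simp only [map_add, map_sub, map_mul, map_pow, map_intCast, GaussianInt.toComplex_def',
        GaussianInt.toComplex_two, GaussianInt.toComplex_four, hA, hB, hC, hD, hF,
        Int.cast_one, Int.cast_zero]
      have hI2 := I_sq
      clear * - hI2 hmk'
      grind)))
  refine ⟨⟨0, 1⟩ * D, ?_⟩
  simp only [map_mul, GaussianInt.toComplex_two] at hD
  simp only [map_mul, GaussianInt.toComplex_def', Int.cast_zero, Int.cast_one]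
  linear_combination (I / 2) * hD - 2 * m ^ 2 * c₃ * I_sq

theorem exists_gaussianInt_of_add_sub {η p q : ℂ} {n : ℤ} (hn : Odd n) (hη : η ^ 2 = -I * n)
    (hp : p ∈ gaussianRat) (hq : q ∈ gaussianRat) (h₁ : IsIntegral ℤ (p + q * η))
    (h₂ : IsIntegral ℤ (p - q * η)) :
    (∃ g : GaussianInt, (g : ℂ) = n * p) ∧ ∃ g : GaussianInt, (g : ℂ) = n * q := by
  have hI := isIntegral_I
  have hIm := I_mem_gaussianRat
  have hni := Complex.isIntegral_intCast n
  have hnm : (n : ℂ) ∈ gaussianRat := intCast_mem _ _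
  have h2m : (2 : ℂ) ∈ gaussianRat := ofNat_mem _ 2
  have hηi : IsIntegral ℤ η := .of_pow (n := 2) (by norm_num) (hη ▸ hI.neg.mul hni)
  obtain ⟨A, hA⟩ := exists_gaussianInt_of_isIntegral (z := 2 * n * p)
    (by
      repeat with_reducible first
        | assumption | apply mul_mem | apply pow_mem | apply add_mem | apply sub_mem | apply neg_mem)
    (isIntegral_of_eq (hni.mul (h₁.add h₂)) (by ring))
  obtain ⟨B, hB⟩ := exists_gaussianInt_of_isIntegral (z := 2 * n * q)
    (by
      repeat with_reducible first
        | assumption | apply mul_mem | apply pow_mem | apply add_mem | apply sub_mem | apply neg_mem)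
    (isIntegral_of_eq (hI.mul ((h₁.sub h₂).mul hηi))
      (by linear_combination (-2 * I * q) * hη + 2 * q * n * I_sq))
  obtain ⟨G, hG⟩ := exists_gaussianInt_of_isIntegral (z := p ^ 2 + I * n * q ^ 2)
    (by
      repeat with_reducible first
        | assumption | apply mul_mem | apply pow_mem | apply add_mem | apply sub_mem | apply neg_mem)
    (isIntegral_of_eq (h₁.mul h₂) (by linear_combination (q ^ 2) * hη))
  obtain ⟨⟨A, rfl⟩, ⟨B, rfl⟩⟩ := GaussianInt.two_dvd_of_four_dvd (A := A) (B := B) hn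
    ⟨n ^ 2 * G, GaussianInt.toComplex_injective (by
      simp [GaussianInt.toComplex_def', GaussianInt.toComplex_four, hA, hB, hG]; ring)⟩
  simp only [map_mul, map_ofNat] at hA hB
  exact ⟨⟨A, by linear_combination hA / 2⟩, ⟨B, by linear_combination hB / 2⟩⟩

theorem exists_gaussianInt_of_even {n : ℤ} (hn : Odd n) (hθm : θ ^ 4 = 2 * n)
    (hc₀ : c₀ ∈ gaussianRat) (hc₁ : c₁ ∈ gaussianRat) (hc₂ : c₂ ∈ gaussianRat)
    (hc₃ : c₃ ∈ gaussianRat)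
    (h : ∀ t, t ^ 4 = (2 * n : ℂ) → IsIntegral ℤ (c₀ + c₁ * t + c₂ * t ^ 2 + c₃ * t ^ 3)) :
    ∃ g : GaussianInt, (g : ℂ) = 2 * n ^ 3 * c₃ := by
  obtain ⟨h₁, h₂, h₃, h₄⟩ := isIntegral_conjugates hθm h
  have hI := isIntegral_I
  have hIm := I_mem_gaussianRat
  have hnm : (n : ℂ) ∈ gaussianRat := intCast_mem _ _
  have h1m : (1 : ℂ) ∈ gaussianRat := one_mem _
  have h2m : (2 : ℂ) ∈ gaussianRat := ofNat_mem _ 2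
  have hni := Complex.isIntegral_intCast n
  have hθ : IsIntegral ℤ θ := .of_pow (n := 4) (by norm_num)
    (hθm ▸ (Complex.isIntegral_intCast 2).mul hni)
  obtain ⟨η, hη⟩ : ∃ η : ℂ, η = (1 - I) * θ ^ 2 / 2 := ⟨_, rfl⟩
  have hη2 : η ^ 2 = -I * n := by
    rw [hη]; linear_combination (θ ^ 4 / 4) * I_sq - (I / 2) * hθm
  have hθη : θ ^ 2 = (1 + I) * η := by rw [hη]; linear_combination (θ ^ 2 / 2) * I_sq
  have hηi : IsIntegral ℤ η := .of_pow (n := 2) (by norm_num) (hη2 ▸ hI.neg.mul hni)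
  obtain ⟨⟨A, hA⟩, ⟨B, hB⟩⟩ := exists_gaussianInt_of_add_sub hn hη2
    (p := 2 * c₀) (q := 2 * (1 + I) * c₂)
    (by
      repeat with_reducible first
        | assumption | apply mul_mem | apply pow_mem | apply add_mem | apply sub_mem | apply neg_mem)
    (by
      repeat with_reducible first
        | assumption | apply mul_mem | apply pow_mem | apply add_mem | apply sub_mem | apply neg_mem)
    (isIntegral_of_eq (h₁.add h₂) (by linear_combination (-2 * c₂) * hθη))
    (isIntegral_of_eq (h₃.add h₄) (by linear_combination (2 * c₂) * hθη))
  obtain ⟨⟨C, hC⟩, ⟨D, hD⟩⟩ := exists_gaussianInt_of_add_sub hn hη2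
    (p := 2 * (1 + I) * n ^ 2 * c₁) (q := 2 * (1 + I) ^ 2 * n ^ 2 * c₃)
    (by
      repeat with_reducible first
        | assumption | apply mul_mem | apply pow_mem | apply add_mem | apply sub_mem | apply neg_mem)
    (by
      repeat with_reducible first
        | assumption | apply mul_mem | apply pow_mem | apply add_mem | apply sub_mem | apply neg_mem)
    (isIntegral_of_eq (((h₁.sub h₂).mul (hθ.mul (hηi.pow 3))).neg) (by
      linear_combination 2 * (c₁ + c₃ * (θ ^ 2 + (1 + I) * η)) * η ^ 3 * hθη +
        2 * (1 + I) * (c₁ + (1 + I) * c₃ * η) * ((η ^ 2 - I * n) * hη2 + n ^ 2 * I_sq)))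
    (isIntegral_of_eq (hI.mul ((h₃.sub h₄).mul (hθ.mul (hηi.pow 3)))) (by
      linear_combination 2 * (c₁ - c₃ * (θ ^ 2 + (1 + I) * η)) * η ^ 3 * hθη +
        2 * (1 + I) * (c₁ - (1 + I) * c₃ * η) * ((η ^ 2 - I * n) * hη2 + n ^ 2 * I_sq) -
        2 * (c₁ * θ ^ 2 - c₃ * θ ^ 4) * η ^ 3 * I_sq))
  obtain ⟨⟨E, hE⟩, ⟨F, hF⟩⟩ := exists_gaussianInt_of_add_sub hn hη2
    (p := c₀ ^ 2 + 2 * n * c₂ ^ 2 - 2 * 2 * n * c₁ * c₃)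
    (q := (1 + I) * (2 * c₀ * c₂ - c₁ ^ 2 - 2 * n * c₃ ^ 2))
    (by
      repeat with_reducible first
        | assumption | apply mul_mem | apply pow_mem | apply add_mem | apply sub_mem | apply neg_mem)
    (by
      repeat with_reducible first
        | assumption | apply mul_mem | apply pow_mem | apply add_mem | apply sub_mem | apply neg_mem)
    (isIntegral_of_eq (h₁.mul h₂) (by
      linear_combination -(c₂ ^ 2 - 2 * c₁ * c₃ - c₃ ^ 2 * θ ^ 2) * hθm -
        (2 * c₀ * c₂ - c₁ ^ 2 - 2 * n * c₃ ^ 2) * hθη))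
    (isIntegral_of_eq (h₃.mul h₄) (by
      linear_combination -(c₂ ^ 2 - 2 * c₁ * c₃ + c₃ ^ 2 * θ ^ 2) * hθm +
        (2 * c₀ * c₂ - c₁ ^ 2 - 2 * n * c₃ ^ 2) * hθη + θ ^ 2 * (c₁ - c₃ * θ ^ 2) ^ 2 * I_sq))
  obtain ⟨D, rfl⟩ := GaussianInt.two_dvd_of_ramified_system hn (A := n ^ 2 * A) (B := n ^ 2 * B)
    (C := C) (D := D) (E := n ^ 5 * E) (F := n ^ 5 * F)
    (GaussianInt.toComplex_injective (by
      simp only [map_add, map_sub, map_mul, map_pow, map_intCast, GaussianInt.toComplex_def',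
        GaussianInt.toComplex_two, GaussianInt.toComplex_four, hA, hB, hC, hD, hE, Int.cast_one,
        Int.cast_zero]
      linear_combination 4 * (1 + I) * n ^ 7 * (2 * c₁ * c₃ - c₂ ^ 2) * (I + 2) * I_sq))
    (GaussianInt.toComplex_injective (by
      simp only [map_sub, map_mul, map_pow, map_intCast, GaussianInt.toComplex_def',
        GaussianInt.toComplex_two, GaussianInt.toComplex_four, hA, hB, hC, hD, hF, Int.cast_one,
        Int.cast_zero]
      linear_combination 4 * (1 + I) ^ 2 * n ^ 7 * c₃ ^ 2 * (I + 2) * I_sq))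
  refine ⟨⟨0, -1⟩ * D, ?_⟩
  simp only [map_mul, GaussianInt.toComplex_two] at hD
  simp only [map_mul, GaussianInt.toComplex_def', Int.cast_zero, Int.cast_neg, Int.cast_one]
  linear_combination (-I / 2) * hD - n ^ 3 * c₃ * (I + 2) * I_sq

end Coordinates

section QuarticRadical

open Polynomial IntermediateField

theorem theta_pow_four (m : ℕ) : theta m ^ 4 = m := by
  rw [theta, ← Complex.ofReal_pow, ← Real.rpow_natCast, ← Real.rpow_mul (by positivity)]
  norm_num

theorem Squarefree.irreducible_X_pow_sub_C {m n : ℕ} (hm : Squarefree m) (h : m ≠ 1)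
    (hn : n ≠ 0) : Irreducible (X ^ n - C (m : ℚ)) := by
  obtain ⟨p, hp, hpm⟩ := Nat.exists_prime_and_dvd h
  have hpZ : Prime (p : ℤ) := Nat.prime_iff_prime_int.mp hp
  have hmonic : (X ^ n - C (m : ℤ)).Monic := monic_X_pow_sub_C _ hn
  have hirr : Irreducible (X ^ n - C (m : ℤ)) := by
    refine irreducible_of_eisenstein_criterion (P := Ideal.span {(p : ℤ)})
      ((Ideal.span_singleton_prime hpZ.ne_zero).mpr hpZ) ?_ ?_ ?_ ?_ hmonic.isPrimitive
    · rw [hmonic.leadingCoeff, Ideal.mem_span_singleton]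
      exact fun h => hpZ.not_isUnit (isUnit_of_dvd_one h)
    · intro k hk
      rw [degree_X_pow_sub_C (Nat.pos_of_ne_zero hn)] at hk
      have hkn : k ≠ n := by rintro rfl; exact lt_irrefl _ hk
      rw [coeff_sub, coeff_X_pow, if_neg hkn, coeff_C, Ideal.mem_span_singleton]
      split_ifs
      · simpa using Int.natCast_dvd_natCast.mpr hpm
      · simp
    · rw [degree_X_pow_sub_C (Nat.pos_of_ne_zero hn)]
      exact_mod_cast Nat.pos_of_ne_zero hn
    · rw [Ideal.span_singleton_pow, Ideal.mem_span_singleton]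
      intro hdvd
      rw [coeff_sub, coeff_X_pow, if_neg hn.symm, coeff_C_zero, zero_sub, dvd_neg] at hdvd
      have : p * p ∣ m := by rw [← sq]; exact_mod_cast hdvd
      exact hp.one_lt.ne' (Nat.isUnit_iff.mp (hm p this))
  simpa using (hmonic.irreducible_iff_irreducible_map_fraction_map (K := ℚ)).mp hirr

theorem finrank_adjoin_theta {m : ℕ} (hm : Squarefree m) (h : m ≠ 1) :
    Module.finrank ℚ ℚ⟮theta m⟯ = 4 := by
  have hroot : aeval (theta m) (X ^ 4 - C (m : ℚ)) = 0 := by simp [theta_pow_four]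
  have hmonic : (X ^ 4 - C (m : ℚ)).Monic := monic_X_pow_sub_C _ (by norm_num)
  rw [adjoin.finrank ⟨_, hmonic, by simpa using hroot⟩,
    ← minpoly.eq_of_irreducible_of_monic (hm.irreducible_X_pow_sub_C h (by norm_num)) hroot hmonic,
    natDegree_X_pow_sub_C]

theorem I_notMem_adjoin_theta (m : ℕ) : Complex.I ∉ ℚ⟮theta m⟯ := by
  intro h
  have hle : ℚ⟮theta m⟯ ≤ (RingHom.toRatAlgHom Complex.ofRealHom).fieldRange := by
    rw [adjoin_simple_le_iff]
    exact ⟨_, rfl⟩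
  obtain ⟨r, hr⟩ := hle h
  have := congrArg Complex.im hr
  simp at this

theorem I_mem_Kfield (m : ℕ) : Complex.I ∈ Kfield m := subset_adjoin _ _ (by simp)

theorem theta_mem_Kfield (m : ℕ) : theta m ∈ Kfield m := subset_adjoin _ _ (by simp)

/-- The imaginary unit of `Kfield m`. -/
noncomputable def imagUnit (m : ℕ) : Kfield m := ⟨Complex.I, I_mem_Kfield m⟩

/-- The real fourth root of `m` in `Kfield m`. -/
noncomputable def fourthRoot (m : ℕ) : Kfield m := ⟨theta m, theta_mem_Kfield m⟩

theorem imagUnit_sq (m : ℕ) : imagUnit m ^ 2 = -1 := Subtype.ext Complex.I_sq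

theorem fourthRoot_pow_four (m : ℕ) : fourthRoot m ^ 4 = m := Subtype.ext (theta_pow_four m)

theorem exists_eq_I_pow_mul {s t : ℂ} (h : s ^ 4 = t ^ 4) :
    ∃ k : Fin 4, s = Complex.I ^ (k : ℕ) * t := by
  have : (s - t) * ((s - Complex.I * t) * ((s + t) * (s + Complex.I * t))) = 0 := by
    linear_combination h + (t ^ 4 - s ^ 2 * t ^ 2) * Complex.I_sq
  rcases mul_eq_zero.mp this with h | h
  · exact ⟨0, by simpa using sub_eq_zero.mp h⟩
  rcases mul_eq_zero.mp h with h | h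
  · exact ⟨1, by simpa using sub_eq_zero.mp h⟩
  rcases mul_eq_zero.mp h with h | h
  · exact ⟨2, by simpa using eq_neg_of_add_eq_zero_left h⟩
  · refine ⟨3, ?_⟩
    have : Complex.I ^ 3 = -Complex.I := Complex.I_pow_three
    simpa [this] using eq_neg_of_add_eq_zero_left h

theorem exists_map_imagUnit {m : ℕ} (σ : Kfield m →ₐ[ℚ] ℂ) :
    ∃ e : Fin 2, σ (imagUnit m) = (-1) ^ (e : ℕ) * Complex.I := by
  have h : σ (imagUnit m) ^ 2 = Complex.I ^ 2 := by
    rw [← map_pow, imagUnit_sq, Complex.I_sq, map_neg, map_one]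
  rcases sq_eq_sq_iff_eq_or_eq_neg.mp h with h | h
  · exact ⟨0, by simpa using h⟩
  · exact ⟨1, by simpa using h⟩

theorem exists_map_fourthRoot {m : ℕ} (σ : Kfield m →ₐ[ℚ] ℂ) :
    ∃ k : Fin 4, σ (fourthRoot m) = Complex.I ^ (k : ℕ) * theta m :=
  exists_eq_I_pow_mul (by rw [← map_pow, fourthRoot_pow_four, theta_pow_four, map_natCast])

theorem exists_bijective_embeddings {m : ℕ} (hm : Squarefree m) (h : m ≠ 1)
    [NumberField (Kfield m)] :
    ∃ f : (Kfield m →ₐ[ℚ] ℂ) → Fin 2 × Fin 4, f.Bijective ∧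
      ∀ σ, σ (imagUnit m) = (-1) ^ ((f σ).1 : ℕ) * Complex.I ∧
        σ (fourthRoot m) = Complex.I ^ ((f σ).2 : ℕ) * theta m := by
  choose e he using fun σ : Kfield m →ₐ[ℚ] ℂ => exists_map_imagUnit σ
  choose k hk using fun σ : Kfield m →ₐ[ℚ] ℂ => exists_map_fourthRoot σ
  have hinj : Function.Injective fun σ => (e σ, k σ) := by
    intro σ τ hστ
    obtain ⟨h₁, h₂⟩ := Prod.mk.inj hστ
    refine algHom_ext_of_eq_adjoin ℚ (S := Kfield m) (s := {Complex.I, theta m}) rfl ?_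
    rintro x (rfl | rfl)
    · exact (he σ).trans (h₁ ▸ (he τ).symm)
    · exact (hk σ).trans (h₂ ▸ (hk τ).symm)
  have hcard : Fintype.card (Kfield m →ₐ[ℚ] ℂ) = Module.finrank ℚ (Kfield m) := AlgHom.card _ _ _
  have hle : Module.finrank ℚ (Kfield m) ≤ 8 := by
    simpa [hcard] using Fintype.card_le_of_injective _ hinj
  have hF : ℚ⟮theta m⟯ ≤ Kfield m := by
    rw [adjoin_simple_le_iff]; exact theta_mem_Kfield m
  have hdvd : 4 ∣ Module.finrank ℚ (Kfield m) := by
    rw [← finrank_adjoin_theta hm h]; exact finrank_dvd_of_le_right hF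
  have hne : Module.finrank ℚ (Kfield m) ≠ 4 := fun h4 =>
    I_notMem_adjoin_theta m (by
      rw [eq_of_le_of_finrank_eq hF (by rw [h4, finrank_adjoin_theta hm h])]
      exact I_mem_Kfield m)
  have hpos : 0 < Module.finrank ℚ (Kfield m) := Module.finrank_pos
  refine ⟨_, (Fintype.bijective_iff_injective_and_card _).mpr ⟨hinj, ?_⟩, fun σ => ⟨he σ, hk σ⟩⟩
  simp only [hcard, Fintype.card_prod, Fintype.card_fin]
  omega

theorem exists_coordinates {m : ℕ} (x : Kfield m) :
    ∃ a b : Fin 4 → ℚ, x = ∑ j, (a j + b j * imagUnit m) * fourthRoot m ^ (j : ℕ) := by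
  suffices h : ∃ c : Fin 4 → gaussianRat, (x : ℂ) = ∑ j, (c j : ℂ) * theta m ^ (j : ℕ) by
    obtain ⟨c, hc⟩ := h
    choose a b hab using fun j => (c j).2
    refine ⟨a, b, Subtype.ext ?_⟩
    simp only [hc, hab]
    push_cast
    rfl
  have halg : ∀ y ∈ ({Complex.I, theta m} : Set ℂ), IsAlgebraic ℚ y := by
    rintro y (rfl | rfl)
    · exact (isIntegral_I.tower_top (A := ℚ)).isAlgebraic
    · exact (IsIntegral.of_pow (n := 4) (by norm_num)
        (by rw [theta_pow_four]; exact isIntegral_algebraMap (A := ℂ) (x := (m : ℚ)))).isAlgebraic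
  have hx : (x : ℂ) ∈ (adjoin ℚ {Complex.I, theta m}).toSubalgebra := x.2
  rw [adjoin_toSubalgebra_of_isAlgebraic halg] at hx
  generalize (x : ℂ) = z at hx
  induction hx using Algebra.adjoin_induction with
  | mem y hy =>
    rcases hy with rfl | rfl
    · exact ⟨![⟨_, I_mem_gaussianRat⟩, 0, 0, 0], by simp [Fin.sum_univ_four]⟩
    · exact ⟨![0, 1, 0, 0], by simp [Fin.sum_univ_four]⟩
  | algebraMap r => exact ⟨![algebraMap ℚ _ r, 0, 0, 0], by simp [Fin.sum_univ_four]⟩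
  | add y z _ _ hy hz =>
    obtain ⟨c, hc⟩ := hy
    obtain ⟨d, hd⟩ := hz
    exact ⟨c + d, by simp [hc, hd, add_mul, Finset.sum_add_distrib]⟩
  | mul y z _ _ hy hz =>
    obtain ⟨c, hc⟩ := hy
    obtain ⟨d, hd⟩ := hz
    refine ⟨![c 0 * d 0 + m * (c 1 * d 3 + c 2 * d 2 + c 3 * d 1),
      c 0 * d 1 + c 1 * d 0 + m * (c 2 * d 3 + c 3 * d 2),
      c 0 * d 2 + c 1 * d 1 + c 2 * d 0 + m * (c 3 * d 3),
      c 0 * d 3 + c 1 * d 2 + c 2 * d 1 + c 3 * d 0], ?_⟩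
    simp [hc, hd, Fin.sum_univ_four, ← theta_pow_four m]
    ring

theorem pow_card_dvd_norm_mul_discr {S ι : Type*} [CommRing S] [Fintype ι] [DecidableEq ι]
    (b : Module.Basis ι ℤ S) {x : S} {d : ℤ} (h : ∀ y, d ∣ Algebra.trace ℤ S (x * y)) :
    d ^ Fintype.card ι ∣ Algebra.norm ℤ x * Algebra.discr ℤ b := by
  have key : (Algebra.leftMulMatrix b x).transpose * Algebra.traceMatrix ℤ b =
      Matrix.of fun i j => Algebra.trace ℤ S (x * (b i * b j)) := by
    ext i j
    rw [Matrix.mul_apply, Matrix.of_apply, ← mul_assoc]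
    conv_rhs => rw [← b.sum_repr (x * b i), Finset.sum_mul, map_sum]
    refine Finset.sum_congr rfl fun k _ => ?_
    rw [Matrix.transpose_apply, Algebra.leftMulMatrix_eq_repr_mul, Algebra.traceMatrix_apply,
      Algebra.traceForm_apply, smul_mul_assoc, map_smul, smul_eq_mul]
  choose q hq using fun i j => h (b i * b j)
  rw [Algebra.norm_eq_matrix_det b, Algebra.discr_def, ← Matrix.det_transpose, ← Matrix.det_mul,
    key, show (Matrix.of fun i j => Algebra.trace ℤ S (x * (b i * b j))) = d • Matrix.of q by
      ext i j; simpa using hq i j, Matrix.det_smul]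
  exact dvd_mul_right _ _

theorem isIntegral_fourthRoot (m : ℕ) : IsIntegral ℤ (fourthRoot m) :=
  IsIntegral.of_pow (n := 4) (by norm_num)
    (by rw [fourthRoot_pow_four]; exact isIntegral_algebraMap (x := (m : ℤ)))

/-- The real fourth root of `m` in the ring of integers of `Kfield m`. -/
noncomputable def intFourthRoot (m : ℕ) : 𝓞 (Kfield m) := ⟨fourthRoot m, isIntegral_fourthRoot m⟩

theorem norm_intFourthRoot {m : ℕ} (hm : Squarefree m) (h : m ≠ 1) [NumberField (Kfield m)] :
    Algebra.norm ℤ (intFourthRoot m) = (m : ℤ) ^ 2 := by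
  obtain ⟨f, hf, hσ⟩ := exists_bijective_embeddings hm h
  have key : algebraMap ℚ ℂ (Algebra.norm ℚ (fourthRoot m)) = (m : ℂ) ^ 2 := by
    rw [Algebra.norm_eq_prod_embeddings]
    simp only [fun σ => (hσ σ).2]
    rw [hf.prod_comp (fun e => Complex.I ^ (e.2 : ℕ) * theta m), Fintype.prod_prod_type]
    simp only [Fin.prod_univ_two, Fin.prod_univ_four, ← theta_pow_four m]
    simp [Complex.I_sq, Complex.I_pow_three]
    ring_nf
    simp [Complex.I_pow_four]
  have : (Algebra.norm ℤ (intFourthRoot m) : ℚ) = Algebra.norm ℚ (fourthRoot m) :=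
    Algebra.coe_norm_int _
  rw [← this] at key
  simp only [eq_ratCast, Rat.cast_intCast] at key
  exact_mod_cast key

theorem dvd_trace_intFourthRoot_mul {m : ℕ} (hm : Squarefree m) (h : m ≠ 1)
    [NumberField (Kfield m)] (y : 𝓞 (Kfield m)) :
    (m : ℤ) ∣ Algebra.trace ℤ _ (intFourthRoot m * y) := by
  obtain ⟨f, hf, hσ⟩ := exists_bijective_embeddings hm h
  set n := Algebra.trace ℤ _ (intFourthRoot m * y) with hn
  have hm0 : m ≠ 0 := hm.ne_zero
  obtain ⟨w, hw, hnw⟩ : ∃ w : ℂ, IsIntegral ℤ w ∧ (n : ℂ) = theta m * w := by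
    refine ⟨∑ σ : Kfield m →ₐ[ℚ] ℂ, Complex.I ^ ((f σ).2 : ℕ) * σ y, IsIntegral.sum _ fun σ _ =>
      (isIntegral_I.pow _).mul (y.2.map (σ.restrictScalars ℤ)), ?_⟩
    have : (n : ℚ) = Algebra.trace ℚ _ (fourthRoot m * y) := Algebra.coe_trace_int _
    have := congrArg (algebraMap ℚ ℂ) this
    rw [trace_eq_sum_embeddings] at this
    rw [Finset.mul_sum]
    refine Eq.trans (by simp) (this.trans (Finset.sum_congr rfl fun σ _ => ?_))
    rw [map_mul, (hσ σ).2]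
    ring
  obtain ⟨k, hk⟩ := exists_int_of_isIntegral (q := n ^ 4 / m)
    (isIntegral_of_eq (hw.pow 4) (by
      push_cast
      rw [hnw, mul_pow, theta_pow_four]
      field_simp))
  have hdvd : (m : ℤ) ∣ n ^ 4 := ⟨k, by
    rw [eq_div_iff (by positivity)] at hk
    have : k * (m : ℤ) = n ^ 4 := by exact_mod_cast hk
    rw [← this, mul_comm]⟩
  exact ((Int.squarefree_natCast.mpr hm).dvd_pow_iff_dvd (by norm_num)).mp hdvd

theorem trace_fourthRoot_mul {m : ℕ} (hm : Squarefree m) (h : m ≠ 1) [NumberField (Kfield m)]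
    (a b : Fin 4 → ℚ) :
    Algebra.trace ℚ _ (fourthRoot m * ∑ j, (a j + b j * imagUnit m) * fourthRoot m ^ (j : ℕ)) =
      8 * m * a 3 := by
  obtain ⟨f, hf, hσ⟩ := exists_bijective_embeddings hm h
  apply (algebraMap ℚ ℂ).injective
  rw [trace_eq_sum_embeddings]
  simp only [map_mul, map_sum, map_add, map_pow, map_ratCast, fun σ => (hσ σ).1,
    fun σ => (hσ σ).2]
  rw [hf.sum_comp (fun e => Complex.I ^ (e.2 : ℕ) * theta m * ∑ j : Fin 4,
    ((a j : ℂ) + b j * ((-1) ^ (e.1 : ℕ) * Complex.I)) *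
      (Complex.I ^ (e.2 : ℕ) * theta m) ^ (j : ℕ)), Fintype.sum_prod_type]
  simp only [map_natCast, ← theta_pow_four m]
  simp [Fin.sum_univ_two, Fin.sum_univ_four, Complex.I_sq, Complex.I_pow_three]
  ring_nf
  simp [Complex.I_sq, Complex.I_pow_four]
  ring

theorem isIntegral_coordinates {m : ℕ} (hm : Squarefree m) (h : m ≠ 1) [NumberField (Kfield m)]
    {a b : Fin 4 → ℚ}
    (hx : IsIntegral ℤ (∑ j, (a j + b j * imagUnit m) * fourthRoot m ^ (j : ℕ)))
    {t : ℂ} (ht : t ^ 4 = m) :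
    IsIntegral ℤ ((a 0 + b 0 * Complex.I : ℂ) + (a 1 + b 1 * Complex.I) * t +
      (a 2 + b 2 * Complex.I) * t ^ 2 + (a 3 + b 3 * Complex.I) * t ^ 3) := by
  obtain ⟨f, hf, hσ⟩ := exists_bijective_embeddings hm h
  obtain ⟨k, rfl⟩ := exists_eq_I_pow_mul (ht.trans (theta_pow_four m).symm)
  obtain ⟨σ, hσk⟩ := hf.2 (0, k)
  have h₁ : σ (imagUnit m) = Complex.I := by simp [(hσ σ).1, hσk]
  have h₂ : σ (fourthRoot m) = Complex.I ^ (k : ℕ) * theta m := by simp [(hσ σ).2, hσk]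
  refine isIntegral_of_eq (hx.map (σ.restrictScalars ℤ)) ?_
  simp [Fin.sum_univ_four, h₁, h₂]

theorem isInt_of_isInt_mul {q : ℚ} {n u v : ℤ} (hn : Odd n) (hu : (u : ℚ) = n * q)
    (hv : (v : ℚ) = 4 * q) : ∃ w : ℤ, (w : ℚ) = q := by
  have hcop : IsCoprime n 4 := by
    have : IsCoprime n 2 := (Int.isCoprime_iff_gcd_eq_one.mpr (by
      simpa [Int.gcd_eq_natAbs] using hn.natAbs.coprime_two_right))
    simpa using this.pow_right (n := 2)
  obtain ⟨r, s, hrs⟩ := hcop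
  refine ⟨r * u + s * v, ?_⟩
  have : (r * n + s * 4 : ℚ) = 1 := by exact_mod_cast hrs
  push_cast
  rw [hu, hv]
  linear_combination q * this

theorem four_mul_dvd_trace {m : ℕ} (hm : Squarefree m) (h23 : m % 4 = 2 ∨ m % 4 = 3)
    [NumberField (Kfield m)] (y : 𝓞 (Kfield m)) :
    4 * (m : ℤ) ∣ Algebra.trace ℤ _ (intFourthRoot m * y) := by
  have h : m ≠ 1 := by omega
  have hm0 : m ≠ 0 := hm.ne_zero
  obtain ⟨v, hv⟩ := dvd_trace_intFourthRoot_mul hm h y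
  obtain ⟨a, b, hy⟩ := exists_coordinates (algebraMap (𝓞 (Kfield m)) (Kfield m) y)
  have htr : (Algebra.trace ℤ _ (intFourthRoot m * y) : ℚ) = 8 * m * a 3 := by
    rw [← trace_fourthRoot_mul hm h a b, ← hy]
    exact Algebra.coe_trace_int _
  have hva : (v : ℚ) = 4 * (2 * a 3) := by
    rw [hv] at htr
    push_cast at htr
    have : (m : ℚ) ≠ 0 := by positivity
    apply mul_left_cancel₀ this
    linear_combination htr
  have hint := RingOfIntegers.isIntegral_coe y
  rw [hy] at hint
  have hconj (t : ℂ) (ht : t ^ 4 = m) := isIntegral_coordinates hm h hint ht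
  have hmem (j : Fin 4) : (a j + b j * Complex.I : ℂ) ∈ gaussianRat := ⟨a j, b j, rfl⟩
  obtain ⟨n, u, hn, hu⟩ : ∃ n u : ℤ, Odd n ∧ (u : ℚ) = n * (2 * a 3) := by
    rcases h23 with h2 | h3
    · obtain ⟨l, rfl⟩ : ∃ l, m = 2 * l := ⟨m / 2, by omega⟩
      have hl : Odd (l : ℤ) := by rw [Int.odd_iff]; omega
      have e : ((2 * l : ℕ) : ℂ) = 2 * ((l : ℤ) : ℂ) := by push_cast; ring
      obtain ⟨g, hg⟩ := exists_gaussianInt_of_even (θ := theta (2 * l)) hl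
        (by rw [theta_pow_four, e])
        (hmem 0) (hmem 1) (hmem 2) (hmem 3) (fun t ht => hconj t (by rw [ht, e]))
      refine ⟨l ^ 3, g.re, hl.pow, ?_⟩
      have := congrArg Complex.re hg
      simp [← Complex.ofReal_natCast, ← Complex.ofReal_pow] at this
      rw [← GaussianInt.intCast_re] at this
      have : (g.re : ℚ) = 2 * l ^ 3 * a 3 := by exact_mod_cast this
      rw [this]
      push_cast
      ring
    · obtain ⟨k, hk⟩ : ∃ k : ℤ, (m : ℤ) = 4 * k - 1 := ⟨(m + 1) / 4, by omega⟩
      obtain ⟨g, hg⟩ := exists_gaussianInt_of_odd (θ := theta m) hk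
        (by rw [theta_pow_four]; simp)
        (hmem 0) (hmem 1) (hmem 2) (hmem 3) (fun t ht => hconj t (by rw [ht]; simp))
      have hodd : Odd (m : ℤ) := by rw [Int.odd_iff]; omega
      refine ⟨m ^ 2, g.re, hodd.pow, ?_⟩
      have := congrArg Complex.re hg
      simp [← Complex.ofReal_natCast, ← Complex.ofReal_pow] at this
      rw [← GaussianInt.intCast_re] at this
      have : (g.re : ℚ) = 2 * m ^ 2 * a 3 := by exact_mod_cast this
      rw [this]
      push_cast
      ring
  obtain ⟨w, hw⟩ := isInt_of_isInt_mul hn hu hva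
  refine ⟨w, ?_⟩
  have : (Algebra.trace ℤ _ (intFourthRoot m * y) : ℚ) = ((4 * m * w : ℤ) : ℚ) := by
    rw [htr]
    push_cast
    rw [hw]
    ring
  exact_mod_cast this

theorem finrank_Kfield {m : ℕ} (hm : Squarefree m) (h : m ≠ 1) [NumberField (Kfield m)] :
    Module.finrank ℚ (Kfield m) = 8 := by
  obtain ⟨f, hf, -⟩ := exists_bijective_embeddings hm h
  rw [← AlgHom.card ℚ (Kfield m) ℂ, Fintype.card_of_bijective hf]
  simp

end QuarticRadical

/-- For squarefree `m ≡ 2, 3 (mod 4)`, `2^16 m^6` divides the absolute value of the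
discriminant of `ℚ(i, m^(1/4))`. -/
theorem stmt_6 (m : ℕ) (hm : Squarefree m) (hpos : 0 < m)
    (h23 : m % 4 = 2 ∨ m % 4 = 3) [NumberField (Kfield m)] :
    (2 ^ 16 * (m : ℤ) ^ 6) ∣ |NumberField.discr (Kfield m)| := by
  have h : m ≠ 1 := by omega
  have hdvd := pow_card_dvd_norm_mul_discr (RingOfIntegers.basis (Kfield m))
    (four_mul_dvd_trace hm h23)
  rw [← Module.finrank_eq_card_basis (RingOfIntegers.basis (Kfield m)), RingOfIntegers.rank,
    finrank_Kfield hm h, norm_intFourthRoot hm h] at hdvd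
  rw [dvd_abs]
  refine (mul_dvd_mul_iff_left (a := (m : ℤ) ^ 2) (by positivity)).mp ?_
  rw [show (m : ℤ) ^ 2 * (2 ^ 16 * m ^ 6) = (4 * m) ^ 8 by ring]
  exact hdvd
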